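/- Let 0 < λ₁ < ⋯ < λ_n, a = diag(λ₁,…,λ_n) ∈ S⁺(n;ℂ), and f_a : G_{n,k} → ℝ, f_a(x) = ‖x − a‖². At every critical point x₀ = σ_I of f_a, the Hessian operator of f_a on T_{x₀}G_{n,k} is given by H_{x₀}(f_a)(u) = (ua − au)x₀ for all u ∈ T_{x₀}G_{n,k} = {u ∈ S⁺(n;ℂ) : x₀u = −ux₀}. Moreover, the gradient field of f_a on G_{n,k} is grad_x f_a = xax − a. -/

import Mathlib

open scoped Matrix

attribute [local instance] Matrix.frobeniusNormedAddCommGroup Matrix.frobeniusNormedSpace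

/-- The inner product `⟨u,v⟩ = Re Tr(u* v)` on complex matrices. -/
noncomputable def mip {n : ℕ} (u v : Matrix (Fin n) (Fin n) ℂ) : ℝ :=
  (Matrix.trace (uᴴ * v)).re

/-- The set of tangent vectors to a subset `M` of the matrix space at a point `x`. -/
def TangentSetAt {n : ℕ} (M : Set (Matrix (Fin n) (Fin n) ℂ)) (x : Matrix (Fin n) (Fin n) ℂ) :
    Set (Matrix (Fin n) (Fin n) ℂ) :=
  {u | ∃ c : ℝ → Matrix (Fin n) (Fin n) ℂ,
    ContDiff ℝ (⊤ : ℕ∞) c ∧ (∀ t, c t ∈ M) ∧ c 0 = x ∧ deriv c 0 = u}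

/-- `G_{n,k}`: Hermitian matrices `x` with `x² = I` and exactly `k` negative eigenvalues. -/
def GrassmannianSet (n k : ℕ) : Set (Matrix (Fin n) (Fin n) ℂ) :=
  {x | x.IsHermitian ∧ x * x = 1 ∧
    ∀ hx : x.IsHermitian, Fintype.card {i // hx.eigenvalues i < 0} = k}

/-- The diagonal matrix `σ_I` with entries `-1` at positions in `I` and `1` elsewhere. -/
def sigmaDiag {n : ℕ} (I : Finset (Fin n)) : Matrix (Fin n) (Fin n) ℂ :=
  Matrix.diagonal (fun j => if j ∈ I then (-1 : ℂ) else 1)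

lemma mip_sub_left {n : ℕ} (u v w : Matrix (Fin n) (Fin n) ℂ) :
    mip (u - v) w = mip u w - mip v w := by
  simp [mip, Matrix.sub_mul, Matrix.trace_sub]

lemma mip_sub_right {n : ℕ} (u v w : Matrix (Fin n) (Fin n) ℂ) :
    mip u (v - w) = mip u v - mip u w := by
  simp [mip, Matrix.mul_sub, Matrix.trace_sub]

lemma mip_comm {n : ℕ} (u v : Matrix (Fin n) (Fin n) ℂ) : mip u v = mip v u := by
  have h : vᴴ * u = (uᴴ * v)ᴴ := by simp
  rw [mip, mip, h, Matrix.trace_conjTranspose]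
  simp

lemma norm_sq_eq_mip {n : ℕ} (y : Matrix (Fin n) (Fin n) ℂ) : ‖y‖ ^ 2 = mip y y := by
  have h0 : 0 ≤ ∑ i, ∑ j, ‖y i j‖ ^ 2 := by positivity
  have h : ‖y‖ ^ 2 = ∑ i, ∑ j, ‖y i j‖ ^ 2 := by
    rw [Matrix.frobenius_norm_def, ← Real.sqrt_eq_rpow]
    simp only [Real.rpow_two]
    exact Real.sq_sqrt h0
  rw [h, mip, Matrix.trace, Finset.sum_comm, Complex.re_sum]
  refine Finset.sum_congr rfl fun j _ => ?_
  rw [Matrix.diag_apply, Matrix.mul_apply, Complex.re_sum]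
  refine Finset.sum_congr rfl fun i _ => ?_
  simp [Complex.sq_norm, Complex.normSq_apply]

lemma hasDerivAt_mip_const {n : ℕ} (a : Matrix (Fin n) (Fin n) ℂ)
    {c : ℝ → Matrix (Fin n) (Fin n) ℂ} {v : Matrix (Fin n) (Fin n) ℂ} {t : ℝ}
    (hc : HasDerivAt c v t) : HasDerivAt (fun s => mip a (c s)) (mip a v) t := by
  let L : Matrix (Fin n) (Fin n) ℂ →ₗ[ℝ] ℝ :=
    { toFun := mip a
      map_add' := fun u w => by simp [mip, Matrix.mul_add, Matrix.trace_add]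
      map_smul' := fun r u => by simp [mip, Matrix.trace_smul] }
  exact L.toContinuousLinearMap.hasFDerivAt.comp_hasDerivAt t hc

section FrobeniusRing

attribute [local instance] Matrix.frobeniusNormedRing Matrix.frobeniusNormedAlgebra

lemma hasDerivAt_matrix_mul {n : ℕ} {c d : ℝ → Matrix (Fin n) (Fin n) ℂ}
    {c' d' : Matrix (Fin n) (Fin n) ℂ} {t : ℝ}
    (hc : HasDerivAt c c' t) (hd : HasDerivAt d d' t) :
    HasDerivAt (fun s => c s * d s) (c' * d t + c t * d') t :=
  hc.mul hd

lemma contDiff_matrix_mul {n : ℕ} {c d : ℝ → Matrix (Fin n) (Fin n) ℂ}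
    (hc : ContDiff ℝ (⊤ : ℕ∞) c) (hd : ContDiff ℝ (⊤ : ℕ∞) d) :
    ContDiff ℝ (⊤ : ℕ∞) (fun s => c s * d s) :=
  ContDiff.mul hc hd

lemma contDiff_matrix_exp_smul {n : ℕ} (w : Matrix (Fin n) (Fin n) ℂ) :
    ContDiff ℝ (⊤ : ℕ∞) (fun t : ℝ => NormedSpace.exp (t • w)) := by
  have h : ContDiff ℝ (⊤ : ℕ∞) (NormedSpace.exp : Matrix (Fin n) (Fin n) ℂ → _) :=
    AnalyticOnNhd.contDiff fun x _ => NormedSpace.exp_analytic (𝕂 := ℝ) x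
  exact h.comp (contDiff_id.smul contDiff_const)

lemma hasDerivAt_matrix_exp_smul_zero {n : ℕ} (w : Matrix (Fin n) (Fin n) ℂ) :
    HasDerivAt (fun t : ℝ => NormedSpace.exp (t • w)) w 0 := by
  have h := hasDerivAt_exp_smul_const (𝕂 := ℝ) w (0 : ℝ)
  rw [zero_smul, NormedSpace.exp_zero, one_mul] at h
  exact h

end FrobeniusRing

/-- Conjugation by a unitary matrix preserves `G_{n,k}`. -/
lemma conj_mem_grassmannianSet {n k : ℕ} {x p : Matrix (Fin n) (Fin n) ℂ}
    (hx : x ∈ GrassmannianSet n k) (h₁ : p * pᴴ = 1) :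
    p * x * pᴴ ∈ GrassmannianSet n k := by
  obtain ⟨hH, hsq, hcard⟩ := hx
  have h₂ : pᴴ * p = 1 := mul_eq_one_comm.mp h₁
  refine ⟨Matrix.isHermitian_mul_mul_conjTranspose p hH, ?_, fun hy => ?_⟩
  · calc p * x * pᴴ * (p * x * pᴴ) = p * x * (pᴴ * p) * x * pᴴ := by simp only [mul_assoc]
      _ = p * (x * x) * pᴴ := by rw [h₂, mul_one, mul_assoc p x x]
      _ = 1 := by rw [hsq, mul_one, h₁]
  · have hchar : (p * x * pᴴ).charpoly = x.charpoly := by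
      rw [Matrix.charpoly_mul_comm, ← mul_assoc, h₂, one_mul]
    have heig : hy.eigenvalues = hH.eigenvalues :=
      (hy.eigenvalues_eq_eigenvalues_iff hH).mpr hchar
    rw [← hcard hH]
    simp only [heig]

/-- Every Hermitian `g` anticommuting with `x` is tangent to `G_{n,k}` at `x`: it is the velocity
of the orbit of `x` under the one-parameter unitary group generated by `g x / 2`. -/
lemma mem_tangentSetAt_of_anticomm {n k : ℕ} {x g : Matrix (Fin n) (Fin n) ℂ}
    (hx : x ∈ GrassmannianSet n k) (hg : g.IsHermitian) (hxg : x * g = -(g * x)) :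
    g ∈ TangentSetAt (GrassmannianSet n k) x := by
  set w : Matrix (Fin n) (Fin n) ℂ := (1 / 2 : ℝ) • (g * x) with hw
  have hskew : wᴴ = -w := by
    simp [hw, Matrix.conjTranspose_smul, hx.1.eq, hg.eq, hxg]
  have hstar (t : ℝ) : (NormedSpace.exp (t • w))ᴴ = NormedSpace.exp (t • -w) := by
    rw [← Matrix.exp_conjTranspose, Matrix.conjTranspose_smul, hskew]
    simp
  have hunit (t : ℝ) : NormedSpace.exp (t • w) * (NormedSpace.exp (t • w))ᴴ = 1 := by
    rw [hstar, smul_neg, ← Matrix.exp_add_of_commute _ _ (Commute.refl (t • w)).neg_right,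
      add_neg_cancel, NormedSpace.exp_zero]
  refine ⟨fun t => NormedSpace.exp (t • w) * x * NormedSpace.exp (t • -w), ?_, fun t => ?_, ?_, ?_⟩
  · exact contDiff_matrix_mul (contDiff_matrix_mul (contDiff_matrix_exp_smul w) contDiff_const)
      (contDiff_matrix_exp_smul (-w))
  · have h := conj_mem_grassmannianSet hx (hunit t)
    rwa [hstar] at h
  · simp
  · have h := hasDerivAt_matrix_mul
      (hasDerivAt_matrix_mul (hasDerivAt_matrix_exp_smul_zero w) (hasDerivAt_const (0 : ℝ) x))
      (hasDerivAt_matrix_exp_smul_zero (-w))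
    refine h.deriv.trans ?_
    have h₁ : g * x * x = g := by rw [mul_assoc, hx.2.1, mul_one]
    have h₂ : x * (g * x) = -g := by rw [← mul_assoc, hxg, neg_mul, h₁]
    simp only [zero_smul, NormedSpace.exp_zero, mul_one, one_mul, mul_zero, add_zero, hw,
      mul_neg, Matrix.smul_mul, Matrix.mul_smul, h₁, h₂, smul_neg, neg_neg, neg_zero]
    rw [← add_smul]
    norm_num

lemma mul_self_conj_sub_anticomm {n : ℕ} {x : Matrix (Fin n) (Fin n) ℂ} (hx : x * x = 1)
    (a : Matrix (Fin n) (Fin n) ℂ) : x * (x * a * x - a) = -((x * a * x - a) * x) := by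
  have h₁ : x * (x * a * x) = a * x := by rw [← mul_assoc, ← mul_assoc, hx, one_mul]
  have h₂ : x * a * x * x = x * a := by rw [mul_assoc, hx, mul_one]
  rw [mul_sub, sub_mul, h₁, h₂, neg_sub]

/-- On `G_{n,k}` the function `‖y - a‖²` is affine in `y`. -/
lemma norm_sub_sq_of_mem {n k : ℕ} {y : Matrix (Fin n) (Fin n) ℂ} (hy : y ∈ GrassmannianSet n k)
    (a : Matrix (Fin n) (Fin n) ℂ) : ‖y - a‖ ^ 2 = n + mip a a - 2 * mip a y := by
  have h : mip y y = n := by simp [mip, hy.1.eq, hy.2.1]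
  rw [norm_sq_eq_mip, mip_sub_left, mip_sub_right, mip_sub_right, h, mip_comm y a]
  ring

lemma mip_conj_of_anticomm {n : ℕ} {x a v : Matrix (Fin n) (Fin n) ℂ} (hx : x.IsHermitian)
    (hsq : x * x = 1) (hv : v * x + x * v = 0) : mip (x * a * x) v = -mip a v := by
  have hxv : x * v = -(v * x) := eq_neg_of_add_eq_zero_right hv
  have h : (x * a * x)ᴴ * v = -(x * (aᴴ * v * x)) := by
    simp only [Matrix.conjTranspose_mul, hx.eq, mul_assoc, hxv, mul_neg]
  rw [mip, mip, h, Matrix.trace_neg, Matrix.trace_mul_comm, mul_assoc, hsq, mul_one,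
    Complex.neg_re]

lemma deriv_distSq_comp {n k : ℕ} {x : Matrix (Fin n) (Fin n) ℂ} (hx : x ∈ GrassmannianSet n k)
    (a : Matrix (Fin n) (Fin n) ℂ) {c : ℝ → Matrix (Fin n) (Fin n) ℂ}
    (hc : DifferentiableAt ℝ c 0) (hmem : ∀ t, c t ∈ GrassmannianSet n k) (h0 : c 0 = x) :
    deriv ((fun y => ‖y - a‖ ^ 2) ∘ c) 0 = mip (x * a * x - a) (deriv c 0) := by
  obtain ⟨v, hd⟩ : ∃ v, HasDerivAt c v 0 := ⟨_, hc.hasDerivAt⟩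
  have hv : v * x + x * v = 0 := by
    have h := hasDerivAt_matrix_mul hd hd
    have hone : (fun s => c s * c s) = fun _ => 1 := funext fun s => (hmem s).2.1
    rw [hone, h0] at h
    exact h.unique (hasDerivAt_const (0 : ℝ) _)
  have hf : (fun y => ‖y - a‖ ^ 2) ∘ c = fun t => n + mip a a - 2 * mip a (c t) :=
    funext fun t => norm_sub_sq_of_mem (hmem t) a
  have h := ((hasDerivAt_mip_const a hd).const_mul 2).const_sub (n + mip a a)
  have hcv : deriv c 0 = v := hd.deriv
  rw [hf, h.deriv, hcv, mip_sub_left, mip_conj_of_anticomm hx.1 hx.2.1 hv]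
  ring

lemma hasDerivAt_gradient {n : ℕ} {s a u : Matrix (Fin n) (Fin n) ℂ} (hsa : s * a = a * s)
    (hsu : s * u = -(u * s)) :
    HasDerivAt (fun t : ℝ => (s + t • u) * a * (s + t • u) - a) ((u * a - a * u) * s) 0 := by
  have h₁ : HasDerivAt (fun t : ℝ => s + t • u) u 0 := by
    have h := ((hasDerivAt_id (0 : ℝ)).smul_const u).const_add s
    rw [one_smul] at h
    exact h
  have h := (hasDerivAt_matrix_mul
    (hasDerivAt_matrix_mul h₁ (hasDerivAt_const (0 : ℝ) a)) h₁).sub_const a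
  refine h.congr_deriv ?_
  simp only [zero_smul, add_zero, mul_zero]
  rw [hsa, mul_assoc a s u, hsu, sub_mul, mul_neg, mul_assoc a u s, sub_eq_add_neg]

/-- For `a = diag(λ₁,…,λ_n)` with `0 < λ₁ < ⋯ < λ_n`:
(i) the gradient field of `f_a(x) = ‖x - a‖²` on `G_{n,k}` is `grad_x f_a = x a x − a`,
i.e. `x a x − a` is tangent to `G_{n,k}` at `x` and `⟨x a x − a, ·⟩` represents the
differential of `f_a|G_{n,k}` at `x`; and
(ii) at every critical point `x₀ = σ_I`, the Hessian operator (the derivative of the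
gradient field) satisfies `H_{x₀}(f_a)(u) = (u a − a u) x₀` for every
`u ∈ T_{x₀}G_{n,k} = {u Hermitian : x₀ u = −u x₀}`. -/
theorem grassmannian_distSq_gradient_hessian (n k : ℕ) (l : Fin n → ℝ)
    (hpos : ∀ i, 0 < l i) (hmono : StrictMono l) :
    (∀ x ∈ GrassmannianSet n k,
      x * Matrix.diagonal (fun i => (l i : ℂ)) * x - Matrix.diagonal (fun i => (l i : ℂ)) ∈
        TangentSetAt (GrassmannianSet n k) x ∧
      ∀ c : ℝ → Matrix (Fin n) (Fin n) ℂ, ContDiff ℝ (⊤ : ℕ∞) c →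
        (∀ t, c t ∈ GrassmannianSet n k) → c 0 = x →
        deriv ((fun y => ‖y - Matrix.diagonal (fun i => (l i : ℂ))‖ ^ 2) ∘ c) 0 =
          mip (x * Matrix.diagonal (fun i => (l i : ℂ)) * x -
            Matrix.diagonal (fun i => (l i : ℂ))) (deriv c 0)) ∧
    (∀ I : Finset (Fin n), I.card = k →
      ∀ u : Matrix (Fin n) (Fin n) ℂ, u.IsHermitian → sigmaDiag I * u = -(u * sigmaDiag I) →
        HasDerivAt
          (fun t : ℝ =>
            (sigmaDiag I + t • u) * Matrix.diagonal (fun i => (l i : ℂ)) *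
                (sigmaDiag I + t • u) - Matrix.diagonal (fun i => (l i : ℂ)))
          ((u * Matrix.diagonal (fun i => (l i : ℂ)) -
              Matrix.diagonal (fun i => (l i : ℂ)) * u) * sigmaDiag I)
          0) := by
  have ha : (Matrix.diagonal fun i => (l i : ℂ)).IsHermitian :=
    Matrix.isHermitian_diagonal_of_self_adjoint _ (by ext i; simp)
  refine ⟨fun x hx => ⟨?_, fun c hc hmem h0 => ?_⟩, fun I _ u _ hsu => ?_⟩
  · have hg : (x * Matrix.diagonal (fun i => (l i : ℂ)) * x).IsHermitian := by
      simpa only [hx.1.eq] using Matrix.isHermitian_mul_mul_conjTranspose x ha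
    exact mem_tangentSetAt_of_anticomm hx (hg.sub ha) (mul_self_conj_sub_anticomm hx.2.1 _)
  · exact deriv_distSq_comp hx _ (hc.differentiable (by simp) 0) hmem h0
  · refine hasDerivAt_gradient ?_ hsu
    simp [sigmaDiag, Matrix.diagonal_mul_diagonal, mul_comm]
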